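/- arXiv:1203.1422 — 4 statements merged into one kernel-verified Lean document; each statement's English description precedes it below -/
import Mathlib

section
/- Let a < b be reals, d a positive integer, g₁, g₂ : [a,b] → ℝ^d continuous functions and α > 0. Then ∫_a^b I^α_- g₁(t) · g₂(t) dt = ∫_a^b g₁(t) · I^α_+ g₂(t) dt, where · denotes the Euclidean inner product on ℝ^d (fractional integration by parts). -/
open Set Filter Topology MeasureTheory RealInnerProductSpace

/-- Left Riemann–Liouville fractional integral of order `α` with inferior limit `a`.
(At `t = a` the integral vanishes, so `Ileft a α g a = 0`.) -/
noncomputable def Ileft {E : Type*} [NormedAddCommGroup E] [NormedSpace ℝ E]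
    (a α : ℝ) (g : ℝ → E) (t : ℝ) : E :=
  (Real.Gamma α)⁻¹ • ∫ y in a..t, (t - y) ^ (α - 1) • g y

/-- Right Riemann–Liouville fractional integral of order `α` with superior limit `b`.
(At `t = b` the integral vanishes, so `Iright b α g b = 0`.) -/
noncomputable def Iright {E : Type*} [NormedAddCommGroup E] [NormedSpace ℝ E]
    (b α : ℝ) (g : ℝ → E) (t : ℝ) : E :=
  (Real.Gamma α)⁻¹ • ∫ y in t..b, (y - t) ^ (α - 1) • g y

section FractionalIntegral

variable {E : Type*} [NormedAddCommGroup E] [InnerProductSpace ℝ E]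

/-- The power kernel `s ↦ s ^ (α - 1)` truncated to `[0, l]`. -/
noncomputable def truncatedPower (α l : ℝ) : ℝ → ℝ :=
  (Icc 0 l).indicator fun s => s ^ (α - 1)

theorem integrable_truncatedPower {α l : ℝ} (hα : 0 < α) (hl : 0 ≤ l) :
    Integrable (truncatedPower α l) := by
  refine IntegrableOn.integrable_indicator ?_ measurableSet_Icc
  rw [← intervalIntegrable_iff_integrableOn_Icc_of_le hl]
  exact intervalIntegral.intervalIntegrable_rpow' (by linarith)

theorem integrable_truncatedPower_mul_inner {α l C : ℝ} (hα : 0 < α) (hl : 0 ≤ l)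
    {u v : ℝ → E} (hu : Integrable u) (hv : AEStronglyMeasurable v) (hC : ∀ t, ‖v t‖ ≤ C) :
    Integrable (fun p : ℝ × ℝ => truncatedPower α l (p.1 - p.2) * ⟪u p.2, v p.1⟫)
      (volume.prod volume) := by
  have h := hu.convolution_integrand (ContinuousLinearMap.lsmul ℝ ℝ).flip
    (integrable_truncatedPower hα hl)
  simp only [ContinuousLinearMap.flip_apply, ContinuousLinearMap.lsmul_apply] at h
  have hm := h.aestronglyMeasurable.inner (𝕜 := ℝ) (hv.comp_fst (ν := volume))
  simp only [real_inner_smul_left] at hm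
  refine (h.norm.mul_const C).mono' hm (Eventually.of_forall fun p => ?_)
  rw [← real_inner_smul_left]
  exact (norm_inner_le_norm _ _).trans (by gcongr; exact hC _)

variable [CompleteSpace E]

theorem inner_Ileft {a t α : ℝ} {g : ℝ → E} (hα : 0 < α) (hat : a ≤ t)
    (hg : ContinuousOn g (Icc a t)) (w : E) :
    ⟪Ileft a α g t, w⟫ = (Real.Gamma α)⁻¹ * ∫ y in a..t, (t - y) ^ (α - 1) * ⟪g y, w⟫ := by
  have hk : IntervalIntegrable (fun y => (t - y) ^ (α - 1)) volume a t := by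
    simpa using (intervalIntegral.intervalIntegrable_rpow' (a := t - a) (b := 0)
      (by linarith : -1 < α - 1)).comp_sub_left t
  have hi := hk.smul_continuousOn (uIcc_of_le hat ▸ hg)
  rw [Ileft, real_inner_smul_left, real_inner_comm, intervalIntegral.integral_of_le hat,
    ← integral_inner ((intervalIntegrable_iff_integrableOn_Ioc_of_le hat).1 hi),
    intervalIntegral.integral_of_le hat]
  simp only [real_inner_smul_right, real_inner_comm w]

theorem inner_Iright {b t α : ℝ} {g : ℝ → E} (hα : 0 < α) (htb : t ≤ b)
    (hg : ContinuousOn g (Icc t b)) (w : E) :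
    ⟪w, Iright b α g t⟫ = (Real.Gamma α)⁻¹ * ∫ y in t..b, (y - t) ^ (α - 1) * ⟪w, g y⟫ := by
  have hk : IntervalIntegrable (fun y => (y - t) ^ (α - 1)) volume t b := by
    simpa using (intervalIntegral.intervalIntegrable_rpow' (a := 0) (b := b - t)
      (by linarith : -1 < α - 1)).comp_sub_right t
  have hi := hk.smul_continuousOn (uIcc_of_le htb ▸ hg)
  rw [Iright, real_inner_smul_right, intervalIntegral.integral_of_le htb,
    ← integral_inner ((intervalIntegrable_iff_integrableOn_Ioc_of_le htb).1 hi),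
    intervalIntegral.integral_of_le htb]
  simp only [real_inner_smul_right]

theorem integral_inner_Ileft {a b α : ℝ} {f g : ℝ → E} (hα : 0 < α) (hab : a ≤ b)
    (hf : ContinuousOn f (Icc a b)) :
    ∫ t in a..b, ⟪Ileft a α f t, g t⟫ = (Real.Gamma α)⁻¹ * ∫ t, ∫ y,
      truncatedPower α (b - a) (t - y) *
        ⟪(Ioc a b).indicator f y, (Ioc a b).indicator g t⟫ := by
  rw [intervalIntegral.integral_of_le hab, ← integral_indicator measurableSet_Ioc,
    ← integral_const_mul]
  congr 1 with t
  by_cases ht : t ∈ Ioc a b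
  · rw [indicator_of_mem ht, indicator_of_mem ht,
      inner_Ileft hα ht.1.le (hf.mono (Icc_subset_Icc_right ht.2)),
      intervalIntegral.integral_of_le ht.1.le, ← integral_indicator measurableSet_Ioc]
    congr 2 with y
    by_cases hy : y ∈ Ioc a t
    · rw [indicator_of_mem hy, indicator_of_mem (Ioc_subset_Ioc_right ht.2 hy), truncatedPower,
        indicator_of_mem (mem_Icc.2 ⟨by linarith [hy.2], by linarith [hy.1, ht.2]⟩)]
    · rw [indicator_of_notMem hy]
      by_cases hyb : y ∈ Ioc a b
      · rw [truncatedPower, indicator_of_notMem fun h => hy ⟨hyb.1, by linarith [h.1]⟩, zero_mul]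
      · rw [indicator_of_notMem hyb, inner_zero_left, mul_zero]
  · simp [indicator_of_notMem ht]

theorem integral_inner_Iright {a b α : ℝ} {f g : ℝ → E} (hα : 0 < α) (hab : a ≤ b)
    (hg : ContinuousOn g (Icc a b)) :
    ∫ t in a..b, ⟪f t, Iright b α g t⟫ = (Real.Gamma α)⁻¹ * ∫ t, ∫ y,
      truncatedPower α (b - a) (y - t) *
        ⟪(Ioc a b).indicator f t, (Ioc a b).indicator g y⟫ := by
  rw [intervalIntegral.integral_of_le hab, ← integral_indicator measurableSet_Ioc,
    ← integral_const_mul]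
  congr 1 with t
  by_cases ht : t ∈ Ioc a b
  · rw [indicator_of_mem ht, indicator_of_mem ht,
      inner_Iright hα ht.2 (hg.mono (Icc_subset_Icc_left ht.1.le)),
      intervalIntegral.integral_of_le ht.2, ← integral_Icc_eq_integral_Ioc,
      ← integral_indicator measurableSet_Icc]
    congr 2 with y
    by_cases hy : y ∈ Icc t b
    · rw [indicator_of_mem hy, indicator_of_mem (mem_Ioc.2 ⟨ht.1.trans_le hy.1, hy.2⟩), truncatedPower,
        indicator_of_mem (mem_Icc.2 ⟨by linarith [hy.1], by linarith [hy.2, ht.1]⟩)]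
    · rw [indicator_of_notMem hy]
      by_cases hyb : y ∈ Ioc a b
      · rw [truncatedPower, indicator_of_notMem fun h => hy ⟨by linarith [h.1], hyb.2⟩, zero_mul]
      · rw [indicator_of_notMem hyb, inner_zero_right, mul_zero]
  · simp [indicator_of_notMem ht]

theorem integral_inner_Ileft_eq_integral_inner_Iright {a b α : ℝ} {f g : ℝ → E} (hα : 0 < α)
    (hab : a ≤ b) (hf : ContinuousOn f (Icc a b)) (hg : ContinuousOn g (Icc a b)) :
    ∫ t in a..b, ⟪Ileft a α f t, g t⟫ = ∫ t in a..b, ⟪f t, Iright b α g t⟫ := by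
  obtain ⟨C, hC⟩ := isCompact_Icc.exists_bound_of_continuousOn hg
  have hu : Integrable ((Ioc a b).indicator f) :=
    (hf.integrableOn_Icc.mono_set Ioc_subset_Icc_self).integrable_indicator measurableSet_Ioc
  have hv : Integrable ((Ioc a b).indicator g) :=
    (hg.integrableOn_Icc.mono_set Ioc_subset_Icc_self).integrable_indicator measurableSet_Ioc
  have hvC (t : ℝ) : ‖(Ioc a b).indicator g t‖ ≤ C := by
    by_cases ht : t ∈ Ioc a b
    · rw [indicator_of_mem ht]
      exact hC t (Ioc_subset_Icc_self ht)
    · rw [indicator_of_notMem ht, norm_zero]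
      exact (norm_nonneg _).trans (hC a (left_mem_Icc.2 hab))
  rw [integral_inner_Ileft hα hab hf, integral_inner_Iright hα hab hg,
    integral_integral_swap (integrable_truncatedPower_mul_inner hα (sub_nonneg.2 hab) hu
      hv.aestronglyMeasurable hvC)]

end FractionalIntegral

/-- Fractional integration by parts. -/
theorem fractional_integration_by_parts
    (a b : ℝ) (hab : a < b) (d : ℕ) (hd : 0 < d)
    (g₁ g₂ : ℝ → EuclideanSpace ℝ (Fin d))
    (hg₁ : ContinuousOn g₁ (Icc a b)) (hg₂ : ContinuousOn g₂ (Icc a b))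
    (α : ℝ) (hα : 0 < α) :
    ∫ t in a..b, ⟪Ileft a α g₁ t, g₂ t⟫ = ∫ t in a..b, ⟪g₁ t, Iright b α g₂ t⟫ := by
  exact integral_inner_Ileft_eq_integral_inner_Iright hα hab.le hg₁ hg₂
end

section
/- Let a < b be reals, d a positive integer, 0 < α < 1, and g : [a,b] → ℝ^d continuous. Then for every t ∈ (a,b), the function s ↦ I^{1-α}_-(I^α_- g)(s) is differentiable at t with derivative g(t); that is, ᶜD^α_-(I^α_- g)(t) = g(t) for all t ∈ (a,b). -/
open Set Filter Topology MeasureTheory RealInnerProductSpace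

theorem integral_rpow_mul_rpow {α z s : ℝ} (hα0 : 0 < α) (hα1 : α < 1) (hzs : z < s) :
    ∫ y in z..s, (s - y) ^ (1 - α - 1) * (y - z) ^ (α - 1) =
      Real.Gamma (1 - α) * Real.Gamma α := by
  have hr : 0 < s - z := sub_pos.2 hzs
  have hB := Complex.betaIntegral_scaled (α : ℂ) ((1 - α : ℝ) : ℂ) hr
  have hG := Complex.Gamma_mul_Gamma_eq_betaIntegral (s := (α : ℂ)) (t := ((1 - α : ℝ) : ℂ))
    (by simpa using hα0) (by simpa using hα1)
  have hsum : (α : ℂ) + ((1 - α : ℝ) : ℂ) = 1 := by push_cast; ring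
  rw [hsum, Complex.Gamma_one, one_mul] at hG
  rw [hsum, sub_self, Complex.cpow_zero, one_mul, ← hG, Complex.Gamma_ofReal,
    Complex.Gamma_ofReal] at hB
  have hshift := intervalIntegral.integral_comp_sub_right (a := z) (b := s)
    (fun x : ℝ => (s - z - x) ^ (1 - α - 1) * x ^ (α - 1)) z
  simp only [sub_sub_sub_cancel_right, sub_self] at hshift
  rw [hshift, mul_comm (Real.Gamma _)]
  apply Complex.ofReal_injective
  rw [Complex.ofReal_mul, ← hB, ← intervalIntegral.integral_ofReal]
  refine intervalIntegral.integral_congr fun x hx => ?_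
  rw [uIcc_of_le hr.le] at hx
  rw [mul_comm, Complex.ofReal_mul, Complex.ofReal_cpow hx.1,
    Complex.ofReal_cpow (sub_nonneg.2 hx.2)]
  push_cast
  rfl

theorem intervalIntegrable_rpow_mul_rpow {α z s : ℝ} (hα0 : 0 < α) (hα1 : α < 1) (hzs : z < s) :
    IntervalIntegrable (fun y => (s - y) ^ (1 - α - 1) * (y - z) ^ (α - 1)) volume z s := by
  apply intervalIntegral.intervalIntegrable_of_integral_ne_zero
  rw [integral_rpow_mul_rpow hα0 hα1 hzs]
  exact (mul_pos (Real.Gamma_pos_of_pos (sub_pos.2 hα1)) (Real.Gamma_pos_of_pos hα0)).ne'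

/-- The kernel of the iterated fractional integral, truncated to `z < y`. -/
noncomputable def abelKernel (α s y z : ℝ) : ℝ :=
  if z < y then (s - y) ^ (1 - α - 1) * (y - z) ^ (α - 1) else 0

theorem abelKernel_nonneg {α s y z : ℝ} (hys : y ≤ s) : 0 ≤ abelKernel α s y z := by
  unfold abelKernel
  split_ifs with h
  · exact mul_nonneg (Real.rpow_nonneg (sub_nonneg.2 hys) _)
      (Real.rpow_nonneg (sub_nonneg.2 h.le) _)
  · exact le_rfl

theorem measurable_abelKernel (α s : ℝ) :
    Measurable fun p : ℝ × ℝ => abelKernel α s p.1 p.2 :=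
  Measurable.ite (measurableSet_lt measurable_snd measurable_fst) (by fun_prop) measurable_const

theorem abelKernel_eq_indicator (α s z : ℝ) :
    (fun y => abelKernel α s y z) =
      (Ioi z).indicator fun y => (s - y) ^ (1 - α - 1) * (y - z) ^ (α - 1) := by
  ext y
  simp [abelKernel, indicator]

theorem Ioo_inter_Ioi_eq {a s z : ℝ} (hz : a ≤ z) : Ioo a s ∩ Ioi z = Ioo z s := by
  ext y
  simp only [mem_inter_iff, mem_Ioo, mem_Ioi]
  grind

theorem integrableOn_abelKernel {α a s z : ℝ} (hα0 : 0 < α) (hα1 : α < 1) (hz : z ∈ Ioo a s) :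
    IntegrableOn (fun y => abelKernel α s y z) (Ioo a s) := by
  rw [abelKernel_eq_indicator, IntegrableOn, integrable_indicator_iff measurableSet_Ioi,
    IntegrableOn, Measure.restrict_restrict measurableSet_Ioi, inter_comm,
    Ioo_inter_Ioi_eq hz.1.le]
  exact (intervalIntegrable_iff_integrableOn_Ioo_of_le hz.2.le).1
    (intervalIntegrable_rpow_mul_rpow hα0 hα1 hz.2)

theorem setIntegral_abelKernel {α a s z : ℝ} (hα0 : 0 < α) (hα1 : α < 1) (hz : z ∈ Ioo a s) :
    ∫ y in Ioo a s, abelKernel α s y z = Real.Gamma (1 - α) * Real.Gamma α := by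
  rw [abelKernel_eq_indicator, setIntegral_indicator measurableSet_Ioi,
    Ioo_inter_Ioi_eq hz.1.le, ← integral_Ioc_eq_integral_Ioo,
    ← intervalIntegral.integral_of_le hz.2.le, integral_rpow_mul_rpow hα0 hα1 hz.2]

section

variable {E : Type*} [NormedAddCommGroup E] [NormedSpace ℝ E]

theorem setIntegral_abelKernel_smul {α a s y : ℝ} (g : ℝ → E) (hy : y ∈ Ioo a s) :
    ∫ z in Ioo a s, abelKernel α s y z • g z =
      (s - y) ^ (1 - α - 1) • ∫ z in a..y, (y - z) ^ (α - 1) • g z := by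
  have h : (fun z => abelKernel α s y z • g z) = (Iio y).indicator fun z =>
      (s - y) ^ (1 - α - 1) • (y - z) ^ (α - 1) • g z := by
    ext z
    by_cases hz : z < y <;> simp [abelKernel, hz, mul_smul]
  have hset : Ioo a s ∩ Iio y = Ioo a y := by
    ext z
    simp only [mem_inter_iff, mem_Ioo, mem_Iio]
    grind
  rw [h, setIntegral_indicator measurableSet_Iio, hset, integral_smul,
    ← integral_Ioc_eq_integral_Ioo, ← intervalIntegral.integral_of_le hy.1.le]

theorem integrable_abelKernel_smul {α a s : ℝ} (hα0 : 0 < α) (hα1 : α < 1) {g : ℝ → E}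
    (hg : IntegrableOn g (Ioo a s)) :
    Integrable (Function.uncurry fun y z => abelKernel α s y z • g z)
      ((volume.restrict (Ioo a s)).prod (volume.restrict (Ioo a s))) := by
  have hmeas : AEStronglyMeasurable (Function.uncurry fun y z => abelKernel α s y z • g z)
      ((volume.restrict (Ioo a s)).prod (volume.restrict (Ioo a s))) :=
    (measurable_abelKernel α s).aestronglyMeasurable.smul hg.aestronglyMeasurable.comp_snd
  refine (integrable_prod_iff' hmeas).2 ⟨?_, ?_⟩
  · filter_upwards [ae_restrict_mem measurableSet_Ioo] with z hz
    exact (integrableOn_abelKernel hα0 hα1 hz).smul_const (g z)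
  · refine (hg.norm.const_mul (Real.Gamma (1 - α) * Real.Gamma α)).congr ?_
    filter_upwards [ae_restrict_mem measurableSet_Ioo] with z hz
    rw [← setIntegral_abelKernel hα0 hα1 hz, ← integral_mul_const]
    refine setIntegral_congr_fun measurableSet_Ioo fun y hy => ?_
    simp only [Function.uncurry, norm_smul]
    rw [Real.norm_of_nonneg (abelKernel_nonneg hy.2.le)]

theorem Ileft_one_sub_Ileft [CompleteSpace E] {α a s : ℝ} (hα0 : 0 < α) (hα1 : α < 1)
    (has : a ≤ s) {g : ℝ → E} (hg : IntegrableOn g (Ioo a s)) :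
    Ileft a (1 - α) (fun y => Ileft a α g y) s = ∫ y in a..s, g y := by
  have hΓ : Real.Gamma α ≠ 0 := (Real.Gamma_pos_of_pos hα0).ne'
  have hΓ' : Real.Gamma (1 - α) ≠ 0 := (Real.Gamma_pos_of_pos (sub_pos.2 hα1)).ne'
  have hswap : ∫ y in Ioo a s, (s - y) ^ (1 - α - 1) • ∫ z in a..y, (y - z) ^ (α - 1) • g z =
      (Real.Gamma (1 - α) * Real.Gamma α) • ∫ z in Ioo a s, g z := by
    calc
      _ = ∫ y in Ioo a s, ∫ z in Ioo a s, abelKernel α s y z • g z :=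
        setIntegral_congr_fun measurableSet_Ioo fun y hy =>
          (setIntegral_abelKernel_smul g hy).symm
      _ = ∫ z in Ioo a s, ∫ y in Ioo a s, abelKernel α s y z • g z :=
        integral_integral_swap (integrable_abelKernel_smul hα0 hα1 hg)
      _ = ∫ z in Ioo a s, (Real.Gamma (1 - α) * Real.Gamma α) • g z := by
        refine setIntegral_congr_fun measurableSet_Ioo fun z hz => ?_
        rw [integral_smul_const, setIntegral_abelKernel hα0 hα1 hz]
      _ = _ := integral_smul _ _
  unfold Ileft
  simp_rw [smul_comm _ (Real.Gamma α)⁻¹]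
  rw [intervalIntegral.integral_smul, intervalIntegral.integral_of_le has,
    intervalIntegral.integral_of_le has, integral_Ioc_eq_integral_Ioo,
    integral_Ioc_eq_integral_Ioo, hswap, smul_smul, smul_smul]
  rw [show (Real.Gamma (1 - α))⁻¹ * (Real.Gamma α)⁻¹ * (Real.Gamma (1 - α) * Real.Gamma α) = 1 by
    field_simp, one_smul]

end

/-- The left Caputo derivative of order `α` of `I^α_- g` is `g`:
for every `t ∈ (a,b)`, `s ↦ I^{1-α}_-(I^α_- g)(s)` is differentiable at `t`
with derivative `g(t)` (note `I^α_- g(a) = 0`, so Caputo and Riemann–Liouville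
derivatives of `I^α_- g` coincide). -/
theorem caputo_of_fracIntegral
    (a b : ℝ) (hab : a < b) (d : ℕ) (hd : 0 < d) (α : ℝ) (hα0 : 0 < α) (hα1 : α < 1)
    (g : ℝ → EuclideanSpace ℝ (Fin d)) (hg : ContinuousOn g (Icc a b)) :
    ∀ t ∈ Ioo a b,
      HasDerivAt (fun s => Ileft a (1 - α) (fun y => Ileft a α g y) s) (g t) t := by
  intro t ht
  have hgt : ContinuousOn g (Icc a t) := hg.mono (Icc_subset_Icc_right ht.2.le)
  have hFTC : HasDerivAt (fun s => ∫ y in a..s, g y) (g t) t :=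
    intervalIntegral.integral_hasDerivAt_right
      (hgt.intervalIntegrable_of_Icc ht.1.le)
      ((hg.mono Ioo_subset_Icc_self).stronglyMeasurableAtFilter isOpen_Ioo t ht)
      (hg.continuousAt (Icc_mem_nhds ht.1 ht.2))
  refine hFTC.congr_of_eventuallyEq ?_
  filter_upwards [Ioo_mem_nhds ht.1 ht.2] with s hs
  exact Ileft_one_sub_Ileft hα0 hα1 hs.1.le
    ((hg.mono (Icc_subset_Icc_right hs.2.le)).integrableOn_Icc.mono_set Ioo_subset_Icc_self)
end

section
/- Let a < b be reals, d a positive integer, 0 < α < 1, and g, h : [a,b] → ℝ^d continuous functions such that for every t ∈ (a,b) the function s ↦ I^{1-α}_-(g - g(a))(s) is differentiable at t with derivative h(t) (that is, h is the continuous extension of the left Caputo derivative ᶜD^α_- g). Then for every t ∈ [a,b] one has I^α_- h(t) = g(t) - g(a). -/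
open Set Filter Topology MeasureTheory RealInnerProductSpace

theorem integral_sub_rpow_mul_sub_rpow {α β z t : ℝ} (hα : 0 < α) (hβ : 0 < β) (hzt : z < t) :
    ∫ y in z..t, (t - y) ^ (α - 1) * (y - z) ^ (β - 1) =
      Real.Gamma α * Real.Gamma β / Real.Gamma (α + β) * (t - z) ^ (α + β - 1) := by
  have hpos : 0 < t - z := sub_pos.2 hzt
  have hshift : ∫ y in z..t, (t - y) ^ (α - 1) * (y - z) ^ (β - 1) =
      ∫ x in (0 : ℝ)..(t - z), x ^ (β - 1) * ((t - z) - x) ^ (α - 1) := by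
    have := intervalIntegral.integral_comp_sub_right (a := z) (b := t)
      (fun x => x ^ (β - 1) * ((t - z) - x) ^ (α - 1)) z
    rw [sub_self] at this
    rw [← this]
    refine intervalIntegral.integral_congr fun y _ => ?_
    simp only [sub_sub_sub_cancel_right]
    ring
  rw [hshift]
  have hscaled := Complex.betaIntegral_scaled (β : ℂ) (α : ℂ) hpos
  have hgamma := Complex.Gamma_mul_Gamma_eq_betaIntegral (s := (β : ℂ)) (t := (α : ℂ))
    (by simpa using hβ) (by simpa using hα)
  have hne : Real.Gamma (α + β) ≠ 0 := (Real.Gamma_pos_of_pos (by positivity)).ne'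
  apply Complex.ofReal_injective
  rw [← intervalIntegral.integral_ofReal]
  have hcast : ∫ x in (0 : ℝ)..(t - z), ((x ^ (β - 1) * ((t - z) - x) ^ (α - 1) : ℝ) : ℂ) =
      ∫ x in (0 : ℝ)..(t - z), (x : ℂ) ^ ((β : ℂ) - 1) * (((t - z : ℝ) : ℂ) - x) ^ ((α : ℂ) - 1) := by
    refine intervalIntegral.integral_congr fun x hx => ?_
    rw [uIcc_of_le hpos.le] at hx
    rw [Complex.ofReal_mul, Complex.ofReal_cpow hx.1, Complex.ofReal_cpow (sub_nonneg.2 hx.2)]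
    push_cast
    rfl
  rw [hcast, hscaled]
  have hbeta : Complex.betaIntegral (β : ℂ) (α : ℂ) =
      ((Real.Gamma α * Real.Gamma β / Real.Gamma (α + β) : ℝ) : ℂ) := by
    rw [← Complex.ofReal_add, Complex.Gamma_ofReal, Complex.Gamma_ofReal, Complex.Gamma_ofReal,
      add_comm β α] at hgamma
    have hne' : (Real.Gamma (α + β) : ℂ) ≠ 0 := Complex.ofReal_ne_zero.2 hne
    push_cast
    rw [eq_div_iff hne']
    linear_combination -hgamma
  rw [hbeta, Complex.ofReal_mul, Complex.ofReal_cpow hpos.le, mul_comm]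
  push_cast
  rw [add_comm (β : ℂ) α]

theorem intervalIntegrable_sub_rpow_mul_sub_rpow {α β z t : ℝ} (hα : 0 < α) (hβ : 0 < β)
    (hzt : z < t) :
    IntervalIntegrable (fun y => (t - y) ^ (α - 1) * (y - z) ^ (β - 1)) volume z t := by
  by_contra hcon
  have h0 := intervalIntegral.integral_undef hcon
  rw [integral_sub_rpow_mul_sub_rpow hα hβ hzt] at h0
  have h1 := Real.Gamma_pos_of_pos hα
  have h2 := Real.Gamma_pos_of_pos hβ
  have h3 := Real.Gamma_pos_of_pos (add_pos hα hβ)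
  have h4 := Real.rpow_pos_of_pos (sub_pos.2 hzt) (α + β - 1)
  exact absurd h0 (by positivity)

theorem intervalIntegrable_sub_rpow {α : ℝ} (hα : 0 < α) (a t : ℝ) :
    IntervalIntegrable (fun y => (t - y) ^ (α - 1)) volume a t := by
  have := (intervalIntegral.intervalIntegrable_rpow' (a := t - a) (b := 0)
    (r := α - 1) (by linarith)).comp_sub_left t
  simpa using this

section FractionalIntegral

variable {E : Type*} [NormedAddCommGroup E] [NormedSpace ℝ E]

theorem Ileft_one (a : ℝ) (f : ℝ → E) (t : ℝ) : Ileft a 1 f t = ∫ y in a..t, f y := by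
  simp [Ileft]

theorem Ileft_congr {a b t : ℝ} (α : ℝ) {f g : ℝ → E} (hfg : EqOn f g (Icc a b))
    (ht : t ∈ Icc a b) : Ileft a α f t = Ileft a α g t := by
  unfold Ileft
  congr 1
  refine intervalIntegral.integral_congr fun y hy => ?_
  rw [uIcc_of_le ht.1] at hy
  simp only [hfg ⟨hy.1, hy.2.trans ht.2⟩]

/-- Rescaling of the fractional integral to the unit interval. -/
theorem Ileft_eq_unit {a α t : ℝ} (hα : 0 < α) (f : ℝ → E) (ht : a ≤ t) :
    Ileft a α f t = (Real.Gamma α)⁻¹ • (t - a) ^ α •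
      ∫ u in (0 : ℝ)..1, (1 - u) ^ (α - 1) • f (a + (t - a) * u) := by
  unfold Ileft
  congr 1
  rcases ht.eq_or_lt with rfl | hlt
  · simp [Real.zero_rpow hα.ne']
  have hpos : 0 < t - a := sub_pos.2 hlt
  have hsub := intervalIntegral.smul_integral_comp_add_mul (a := 0) (b := 1)
    (fun y => (t - y) ^ (α - 1) • f y) (t - a) a
  simp only [mul_zero, add_zero, mul_one, add_sub_cancel] at hsub
  rw [← hsub, ← intervalIntegral.integral_smul, ← intervalIntegral.integral_smul]
  refine intervalIntegral.integral_congr fun u hu => ?_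
  rw [uIcc_of_le zero_le_one] at hu
  simp only [smul_smul]
  have hmul : t - (a + (t - a) * u) = (t - a) * (1 - u) := by ring
  rw [hmul, Real.mul_rpow hpos.le (sub_nonneg.2 hu.2), ← mul_assoc]
  congr 2
  rw [Real.rpow_sub_one hpos.ne']
  field_simp

theorem continuousOn_Ileft {a b α : ℝ} (hα : 0 < α) {f : ℝ → E}
    (hf : ContinuousOn f (Icc a b)) : ContinuousOn (Ileft a α f) (Icc a b) := by
  have hmem : ∀ t ∈ Icc a b, ∀ u ∈ Icc (0 : ℝ) 1, a + (t - a) * u ∈ Icc a b := by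
    intro t ht u hu
    have h1 := mul_nonneg (sub_nonneg.2 ht.1) hu.1
    have h2 := mul_le_of_le_one_right (sub_nonneg.2 ht.1) hu.2
    exact ⟨by linarith, by linarith [ht.2]⟩
  obtain ⟨M, hM⟩ := isCompact_Icc.exists_bound_of_continuousOn hf
  refine ContinuousOn.congr ?_ fun t ht => Ileft_eq_unit hα f ht.1
  refine ContinuousOn.const_smul (ContinuousOn.smul ?_ ?_) _
  · exact ((continuous_id.sub continuous_const).rpow_const fun _ => Or.inr hα.le).continuousOn
  intro t₀ ht₀
  refine intervalIntegral.continuousWithinAt_of_dominated_interval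
    (bound := fun u => (1 - u) ^ (α - 1) * M) ?_ ?_ ?_ ?_
  · filter_upwards [self_mem_nhdsWithin] with t ht
    rw [uIoc_of_le zero_le_one]
    refine AEStronglyMeasurable.smul
      (Measurable.aestronglyMeasurable (by fun_prop)) ?_
    have hcont : ContinuousOn (fun u : ℝ => f (a + (t - a) * u)) (Icc 0 1) :=
      hf.comp (by fun_prop) (hmem t ht)
    exact (hcont.mono Ioc_subset_Icc_self).aestronglyMeasurable measurableSet_Ioc
  · filter_upwards [self_mem_nhdsWithin] with t ht
    refine Eventually.of_forall fun u hu => ?_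
    rw [uIoc_of_le zero_le_one] at hu
    have hu' := Ioc_subset_Icc_self hu
    have hnn : (0 : ℝ) ≤ (1 - u) ^ (α - 1) := Real.rpow_nonneg (sub_nonneg.2 hu'.2) _
    rw [norm_smul, Real.norm_of_nonneg hnn]
    exact mul_le_mul_of_nonneg_left (hM _ (hmem t ht u hu')) hnn
  · exact (intervalIntegrable_sub_rpow hα 0 1).mul_const M
  · refine Eventually.of_forall fun u hu => ?_
    rw [uIoc_of_le zero_le_one] at hu
    refine ContinuousWithinAt.const_smul ?_ _
    exact (hf _ (hmem t₀ ht₀ u (Ioc_subset_Icc_self hu))).comp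
      (f := fun t => a + (t - a) * u) (by fun_prop) fun t ht =>
        hmem t ht u (Ioc_subset_Icc_self hu)

/-- Semigroup property of the Riemann–Liouville fractional integral on continuous functions. -/
theorem Ileft_Ileft {a t α β : ℝ} (hα : 0 < α) (hβ : 0 < β) (hat : a ≤ t) {f : ℝ → E}
    [CompleteSpace E]
    (hf : ContinuousOn f (Icc a t)) :
    Ileft a α (Ileft a β f) t = Ileft a (α + β) f t := by
  set C := Real.Gamma α * Real.Gamma β / Real.Gamma (α + β) with hC
  set μ := (volume : Measure ℝ).restrict (Ioc a t) with hμ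
  let K : ℝ → ℝ → ℝ := fun y z => (t - y) ^ (α - 1) * (y - z) ^ (β - 1)
  let G : ℝ × ℝ → E := {p : ℝ × ℝ | p.2 < p.1}.indicator fun p => K p.1 p.2 • f p.2
  have hG₁ : ∀ z, (fun y => G (y, z)) = (Ioi z).indicator fun y => K y z • f z := fun z => rfl
  have hG₂ : ∀ y, (fun z => G (y, z)) = (Iio y).indicator fun z => K y z • f z := fun y => rfl
  have hres₁ : ∀ z ∈ Ioc a t, μ.restrict (Ioi z) = volume.restrict (Ioc z t) := by
    intro z hz
    rw [hμ, Measure.restrict_restrict measurableSet_Ioi]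
    congr 1
    ext y
    simp only [mem_inter_iff, mem_Ioi, mem_Ioc]
    exact ⟨fun h => ⟨h.1, h.2.2⟩, fun h => ⟨h.1, hz.1.trans h.1, h.2⟩⟩
  have hKint : ∀ z < t, Integrable (fun y => K y z) (volume.restrict (Ioc z t)) := fun z hz =>
    (intervalIntegrable_iff_integrableOn_Ioc_of_le hz.le).1
      (intervalIntegrable_sub_rpow_mul_sub_rpow hα hβ hz)
  have hKval : ∀ z < t, ∫ y in Ioc z t, K y z = C * (t - z) ^ (α + β - 1) := fun z hz => by
    rw [← intervalIntegral.integral_of_le hz.le]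
    exact integral_sub_rpow_mul_sub_rpow hα hβ hz
  have hae : ∀ᵐ z ∂μ, z ∈ Ioc a t ∧ z < t := by
    have hne : ∀ᵐ z ∂μ, z ≠ t := by
      refine ae_restrict_of_ae ?_
      simp [ae_iff]
    filter_upwards [ae_restrict_mem measurableSet_Ioc, hne] with z hz hzt
    exact ⟨hz, lt_of_le_of_ne hz.2 hzt⟩
  have hfm : AEStronglyMeasurable f μ :=
    (hf.mono Ioc_subset_Icc_self).aestronglyMeasurable measurableSet_Ioc
  have hGm : AEStronglyMeasurable G (μ.prod μ) := by
    refine AEStronglyMeasurable.indicator ?_ (measurableSet_lt measurable_snd measurable_fst)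
    refine AEStronglyMeasurable.smul ?_ hfm.comp_snd
    have : Measurable fun p : ℝ × ℝ => K p.1 p.2 := by fun_prop
    exact this.aestronglyMeasurable
  have hGint : Integrable G (μ.prod μ) := by
    refine (integrable_prod_iff' hGm).2 ⟨?_, ?_⟩
    · filter_upwards [hae] with z hz
      rw [hG₁, integrable_indicator_iff measurableSet_Ioi, IntegrableOn, hres₁ z hz.1]
      exact (hKint z hz.2).smul_const _
    · have hdom : Integrable (fun z => (C * (t - z) ^ (α + β - 1)) * ‖f z‖) μ := by
        have h1 : IntervalIntegrable (fun z => (C * (t - z) ^ (α + β - 1)) * ‖f z‖) volume a t := by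
          refine IntervalIntegrable.mul_continuousOn
            ((intervalIntegrable_sub_rpow (add_pos hα hβ) a t).const_mul C) ?_
          rw [uIcc_of_le hat]
          exact hf.norm
        exact (intervalIntegrable_iff_integrableOn_Ioc_of_le hat).1 h1
      refine hdom.congr ?_
      filter_upwards [hae] with z hz
      have hnorm : (fun y => ‖G (y, z)‖) = (Ioi z).indicator fun y => ‖K y z • f z‖ := by
        funext y
        rw [congrFun (hG₁ z) y, norm_indicator_eq_indicator_norm]
      rw [hnorm, integral_indicator measurableSet_Ioi, hres₁ z hz.1, ← hKval z hz.2,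
        ← integral_mul_const]
      refine setIntegral_congr_fun measurableSet_Ioc fun y hy => ?_
      rw [norm_smul, Real.norm_of_nonneg]
      exact mul_nonneg (Real.rpow_nonneg (sub_nonneg.2 hy.2) _)
        (Real.rpow_nonneg (sub_nonneg.2 hy.1.le) _)
  have hswap := integral_integral_swap (f := fun y z => G (y, z)) hGint
  have hleft : ∫ y, ∫ z, G (y, z) ∂μ ∂μ =
      ∫ y in a..t, (t - y) ^ (α - 1) • ∫ z in a..y, (y - z) ^ (β - 1) • f z := by
    rw [intervalIntegral.integral_of_le hat]
    refine setIntegral_congr_fun measurableSet_Ioc fun y hy => ?_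
    have hset : Iio y ∩ Ioc a t = Ioo a y := by
      ext z
      simp only [mem_inter_iff, mem_Iio, mem_Ioc, mem_Ioo]
      exact ⟨fun h => ⟨h.2.1, h.1⟩, fun h => ⟨h.2, h.1, h.2.le.trans hy.2⟩⟩
    rw [hG₂, integral_indicator measurableSet_Iio, hμ,
      Measure.restrict_restrict measurableSet_Iio, hset, ← integral_Ioc_eq_integral_Ioo,
      ← intervalIntegral.integral_of_le hy.1.le, ← intervalIntegral.integral_smul]
    simp only [K, mul_smul]
  have hright : ∫ z, ∫ y, G (y, z) ∂μ ∂μ =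
      C • ∫ z in a..t, (t - z) ^ (α + β - 1) • f z := by
    rw [intervalIntegral.integral_of_le hat, ← integral_smul]
    refine integral_congr_ae ?_
    filter_upwards [hae] with z hz
    rw [hG₁, integral_indicator measurableSet_Ioi, hres₁ z hz.1, integral_smul_const,
      hKval z hz.2, mul_smul]
  rw [hleft, hright] at hswap
  have hα' := (Real.Gamma_pos_of_pos hα).ne'
  have hβ' := (Real.Gamma_pos_of_pos hβ).ne'
  unfold Ileft
  simp only [smul_comm _ (Real.Gamma β)⁻¹]
  rw [intervalIntegral.integral_smul, hswap, smul_smul, smul_smul]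
  congr 1
  rw [hC]
  field_simp

theorem eqOn_of_integral_eq [CompleteSpace E] {a b : ℝ} (hab : a < b) {f g : ℝ → E}
    (hf : ContinuousOn f (Icc a b)) (hg : ContinuousOn g (Icc a b))
    (hfg : ∀ t ∈ Icc a b, ∫ y in a..t, f y = ∫ y in a..t, g y) : EqOn f g (Icc a b) := by
  have hderiv : ∀ {k : ℝ → E}, ContinuousOn k (Icc a b) → ∀ t ∈ Ioo a b,
      HasDerivAt (fun s => ∫ y in a..s, k y) (k t) t := by
    intro k hk t ht
    refine intervalIntegral.integral_hasDerivAt_right ?_ ?_ ?_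
    · refine ContinuousOn.intervalIntegrable ?_
      rw [uIcc_of_le ht.1.le]
      exact hk.mono (Icc_subset_Icc_right ht.2.le)
    · exact (hk.mono Ioo_subset_Icc_self).stronglyMeasurableAtFilter isOpen_Ioo t ht
    · exact hk.continuousAt (Icc_mem_nhds ht.1 ht.2)
  have hIoo : EqOn f g (Ioo a b) := by
    intro t ht
    refine (hderiv hf t ht).unique ((hderiv hg t ht).congr_of_eventuallyEq ?_)
    filter_upwards [Icc_mem_nhds ht.1 ht.2] with s hs using hfg s hs
  exact hIoo.of_subset_closure hf hg Ioo_subset_Icc_self (closure_Ioo hab.ne).ge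

end FractionalIntegral

/-- If `h` is the (continuous extension of the) left Caputo derivative of order `α` of `g`,
then `I^α_- h = g - g(a)` on `[a,b]`. -/
theorem fracIntegral_of_caputo
    (a b : ℝ) (hab : a < b) (d : ℕ) (hd : 0 < d) (α : ℝ) (hα0 : 0 < α) (hα1 : α < 1)
    (g h : ℝ → EuclideanSpace ℝ (Fin d))
    (hg : ContinuousOn g (Icc a b)) (hh : ContinuousOn h (Icc a b))
    (hder : ∀ t ∈ Ioo a b,
      HasDerivAt (fun s => Ileft a (1 - α) (fun y => g y - g a) s) (h t) t) :
    ∀ t ∈ Icc a b, Ileft a α h t = g t - g a := by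
  have hf : ContinuousOn (fun y => g y - g a) (Icc a b) := hg.sub continuousOn_const
  have hF := continuousOn_Ileft (sub_pos.2 hα1) hf
  have hprim : EqOn (Ileft a (1 - α) fun y => g y - g a) (Ileft a 1 h) (Icc a b) := by
    intro t ht
    rw [Ileft_one, intervalIntegral.integral_eq_sub_of_hasDerivAt_of_le ht.1
      (hF.mono (Icc_subset_Icc_right ht.2))
      (fun s hs => hder s ⟨hs.1, hs.2.trans_le ht.2⟩)]
    · simp [Ileft]
    · refine ContinuousOn.intervalIntegrable ?_
      rw [uIcc_of_le ht.1]
      exact hh.mono (Icc_subset_Icc_right ht.2)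
  refine eqOn_of_integral_eq hab (continuousOn_Ileft hα0 hh) hf fun t ht => ?_
  have hsub : Icc a t ⊆ Icc a b := Icc_subset_Icc_right ht.2
  rw [← Ileft_one, ← Ileft_one, Ileft_Ileft one_pos hα0 ht.1 (hh.mono hsub), add_comm,
    ← Ileft_Ileft hα0 one_pos ht.1 (hh.mono hsub), ← Ileft_congr α hprim ht,
    Ileft_Ileft hα0 (sub_pos.2 hα1) ht.1 (hf.mono hsub), add_sub_cancel]
end

section
/- Stability of order 2 for the fractional state equation: let a < b, d, m positive integers, 0 < α ≤ 1, A ∈ ℝ^d, and f : ℝ^d × ℝ^m × [a,b] → ℝ^d of class C² satisfying ‖f(x₁,v,t) - f(x₂,v,t)‖ ≤ M ‖x₁ - x₂‖ for some M ≥ 0 and all x₁, x₂, v, t. Let u, ū : [a,b] → ℝ^m be continuous, let Q : ℝ → ([a,b] → ℝ^d) be such that for every ε, Q(ε) is continuous and satisfies Q(ε)(t) = A + I^α_-(s ↦ f(Q(ε)(s), u(s) + ε ū(s), s))(t) for all t ∈ [a,b], and let q̄ : [a,b] → ℝ^d be the continuous function satisfying q̄(t) = I^α_-(s ↦ (∂f/∂x)(Q(0)(s),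 u(s), s) · q̄(s) + (∂f/∂v)(Q(0)(s), u(s), s) · ū(s))(t) for all t ∈ [a,b]. Then there exists a constant C ≥ 0 such that for all ε with |ε| < 1 and all t ∈ [a,b], ‖Q(ε)(t) - Q(0)(t) - ε q̄(t)‖ ≤ C ε². -/
open Set Filter Topology MeasureTheory RealInnerProductSpace

theorem intervalIntegrable_sub_rpow_smul {E : Type*} [NormedAddCommGroup E] [NormedSpace ℝ E]
    {a α t : ℝ} (hα : 0 < α) (hat : a ≤ t) {g : ℝ → E} (hg : ContinuousOn g (Icc a t)) :
    IntervalIntegrable (fun y => (t - y) ^ (α - 1) • g y) volume a t := by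
  have h := (intervalIntegral.intervalIntegrable_rpow' (a := t - a) (b := 0)
    (show -1 < α - 1 by linarith)).comp_sub_left t
  simp only [sub_sub_cancel, sub_zero] at h
  exact h.smul_continuousOn (by rwa [uIcc_of_le hat])

theorem Ileft_sub {E : Type*} [NormedAddCommGroup E] [NormedSpace ℝ E]
    {a b α t : ℝ} (hα : 0 < α) (ht : t ∈ Icc a b) {g h : ℝ → E}
    (hg : ContinuousOn g (Icc a b)) (hh : ContinuousOn h (Icc a b)) :
    Ileft a α (fun s => g s - h s) t = Ileft a α g t - Ileft a α h t := by
  have hsub : Icc a t ⊆ Icc a b := Icc_subset_Icc_right ht.2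
  simp only [Ileft, smul_sub]
  rw [intervalIntegral.integral_sub (intervalIntegrable_sub_rpow_smul hα ht.1 (hg.mono hsub))
    (intervalIntegrable_sub_rpow_smul hα ht.1 (hh.mono hsub)), smul_sub]

theorem Ileft_const_smul {E : Type*} [NormedAddCommGroup E] [NormedSpace ℝ E]
    (a α c t : ℝ) (g : ℝ → E) :
    Ileft a α (fun s => c • g s) t = c • Ileft a α g t := by
  simp only [Ileft, smul_comm _ c, intervalIntegral.integral_smul]

theorem integral_sub_rpow_mul_exp_le {a α l t : ℝ} (hα : 0 < α) (hl : 0 < l) (hat : a ≤ t) :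
    ∫ y in a..t, (t - y) ^ (α - 1) * Real.exp (l * (y - a)) ≤
      (1 / l) ^ α * Real.Gamma α * Real.exp (l * (t - a)) := by
  have hint : IntegrableOn (fun r : ℝ => r ^ (α - 1) * Real.exp (-(l * r))) (Ioi 0) := by
    have := integrableOn_rpow_mul_exp_neg_mul_rpow (show -1 < α - 1 by linarith) one_pos hl
    simpa only [Real.rpow_one, neg_mul] using this
  have hcomp : ∀ y, (t - y) ^ (α - 1) * Real.exp (l * (y - a)) =
      (fun r : ℝ => r ^ (α - 1) * Real.exp (-(l * r)) * Real.exp (l * (t - a))) (t - y) := by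
    intro y
    simp only [mul_assoc, ← Real.exp_add]
    ring_nf
  simp only [hcomp]
  rw [intervalIntegral.integral_comp_sub_left
      (fun r : ℝ => r ^ (α - 1) * Real.exp (-(l * r)) * Real.exp (l * (t - a))) t, sub_self,
    intervalIntegral.integral_mul_const, ← Real.integral_rpow_mul_exp_neg_mul_Ioi hα hl,
    intervalIntegral.integral_of_le (sub_nonneg.2 hat)]
  refine mul_le_mul_of_nonneg_right (setIntegral_mono_set hint ?_ ?_) (Real.exp_pos _).le
  · filter_upwards [ae_restrict_mem measurableSet_Ioi] with r hr
    exact mul_nonneg (Real.rpow_nonneg (le_of_lt hr) _) (Real.exp_pos _).le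
  · exact Ioc_subset_Ioi_self.eventuallyLE

theorem norm_Ileft_le_of_norm_le_exp {E : Type*} [NormedAddCommGroup E] [NormedSpace ℝ E]
    {a α l t K : ℝ} (hα : 0 < α) (hl : 0 < l) (hat : a ≤ t) (hK : 0 ≤ K) {g : ℝ → E}
    (hg : ∀ s ∈ Icc a t, ‖g s‖ ≤ K * Real.exp (l * (s - a))) :
    ‖Ileft a α g t‖ ≤ K * (1 / l) ^ α * Real.exp (l * (t - a)) := by
  have hΓ := Real.Gamma_pos_of_pos hα
  have hint : IntervalIntegrable
      (fun y => K * ((t - y) ^ (α - 1) * Real.exp (l * (y - a)))) volume a t :=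
    (intervalIntegrable_sub_rpow_smul hα hat (by fun_prop)).const_mul K
  have hle : ‖∫ y in a..t, (t - y) ^ (α - 1) • g y‖ ≤
      ∫ y in a..t, K * ((t - y) ^ (α - 1) * Real.exp (l * (y - a))) := by
    refine intervalIntegral.norm_integral_le_of_norm_le hat (ae_of_all _ fun y hy => ?_) hint
    have hpow : 0 ≤ (t - y) ^ (α - 1) := Real.rpow_nonneg (sub_nonneg.2 hy.2) _
    rw [norm_smul, Real.norm_of_nonneg hpow, mul_left_comm]
    exact mul_le_mul_of_nonneg_left (hg y (Ioc_subset_Icc_self hy)) hpow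
  rw [intervalIntegral.integral_const_mul] at hle
  rw [Ileft, norm_smul, Real.norm_of_nonneg (inv_nonneg.2 hΓ.le), inv_mul_le_iff₀ hΓ]
  calc _ ≤ _ := hle
    _ ≤ K * ((1 / l) ^ α * Real.Gamma α * Real.exp (l * (t - a))) :=
      mul_le_mul_of_nonneg_left (integral_sub_rpow_mul_exp_le hα hl hat) hK
    _ = _ := by ring

/-- Fractional Grönwall inequality, proved with an exponentially weighted supremum norm. -/
theorem exists_norm_le_of_eq_Ileft {E : Type*} [NormedAddCommGroup E] [NormedSpace ℝ E]
    (a b : ℝ) {α M : ℝ} (hα : 0 < α) (hM : 0 ≤ M) :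
    ∃ C : ℝ, 0 ≤ C ∧ ∀ (w h : ℝ → E) (c : ℝ), 0 ≤ c → ContinuousOn w (Icc a b) →
      (∀ t ∈ Icc a b, w t = Ileft a α h t) →
      (∀ t ∈ Icc a b, ‖h t‖ ≤ M * ‖w t‖ + c) → ∀ t ∈ Icc a b, ‖w t‖ ≤ C * c := by
  obtain ⟨l, hl, hlα⟩ : ∃ l : ℝ, 0 < l ∧ (1 / l) ^ α = 1 / (M + 1) := by
    have hM1 : 0 < M + 1 := by linarith
    refine ⟨(M + 1) ^ α⁻¹, Real.rpow_pos_of_pos hM1 _, ?_⟩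
    rw [Real.div_rpow zero_le_one (Real.rpow_nonneg hM1.le _), Real.one_rpow,
      Real.rpow_inv_rpow hM1.le hα.ne']
  refine ⟨Real.exp (l * (b - a)), (Real.exp_pos _).le, fun w h c hc hw hwh hh t ht => ?_⟩
  obtain ⟨t₀, ht₀, hmax⟩ := isCompact_Icc.exists_isMaxOn ⟨t, ht⟩
    (show ContinuousOn (fun s => ‖w s‖ * Real.exp (-(l * (s - a)))) (Icc a b) by fun_prop)
  set S := ‖w t₀‖ * Real.exp (-(l * (t₀ - a))) with hS
  have hS0 : 0 ≤ S := by positivity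
  have hwS : ∀ s ∈ Icc a b, ‖w s‖ ≤ S * Real.exp (l * (s - a)) := by
    intro s hs
    have hms : ‖w s‖ * Real.exp (-(l * (s - a))) ≤ S := hmax hs
    rwa [Real.exp_neg, ← div_eq_mul_inv, div_le_iff₀ (Real.exp_pos _)] at hms
  have hbound : ‖w t₀‖ ≤ (M * S + c) * (1 / l) ^ α * Real.exp (l * (t₀ - a)) := by
    rw [hwh t₀ ht₀]
    refine norm_Ileft_le_of_norm_le_exp hα hl ht₀.1 (by positivity) fun s hs => ?_
    have hs' : s ∈ Icc a b := ⟨hs.1, hs.2.trans ht₀.2⟩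
    have hexp : 1 ≤ Real.exp (l * (s - a)) :=
      Real.one_le_exp (mul_nonneg hl.le (sub_nonneg.2 hs.1))
    calc ‖h s‖ ≤ M * ‖w s‖ + c := hh s hs'
      _ ≤ M * (S * Real.exp (l * (s - a))) + c * Real.exp (l * (s - a)) :=
        add_le_add (mul_le_mul_of_nonneg_left (hwS s hs') hM) (le_mul_of_one_le_right hc hexp)
      _ = _ := by ring
  have hSc : S ≤ c := by
    have h1 : S ≤ (M * S + c) * (1 / l) ^ α := by
      rwa [hS, Real.exp_neg, ← div_eq_mul_inv, div_le_iff₀ (Real.exp_pos _),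
        div_eq_mul_inv, ← Real.exp_neg, ← hS]
    rw [hlα, mul_one_div, le_div_iff₀ (by linarith)] at h1
    linarith
  calc ‖w t‖ ≤ S * Real.exp (l * (t - a)) := hwS t ht
    _ ≤ c * Real.exp (l * (b - a)) := by
      have := ht.2
      gcongr
    _ = _ := mul_comm _ _

theorem ContDiffOn.exists_lipschitz_taylor_bound {E G : Type*} [NormedAddCommGroup E]
    [NormedSpace ℝ E] [NormedAddCommGroup G] [NormedSpace ℝ G] {F : E → G} {S K : Set E}
    (hF : ContDiffOn ℝ 2 F S) (hS : UniqueDiffOn ℝ S) (hK : IsCompact K) (hKc : Convex ℝ K)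
    (hKS : K ⊆ S) :
    ∃ B : ℝ, 0 ≤ B ∧ ∀ p ∈ K, ∀ q ∈ K, ‖F q - F p‖ ≤ B * ‖q - p‖ ∧
      ‖F q - F p - fderivWithin ℝ F S p (q - p)‖ ≤ B * ‖q - p‖ ^ 2 := by
  have hF' : ContDiffOn ℝ 1 (fderivWithin ℝ F S) S := hF.fderivWithin hS (by norm_num)
  obtain ⟨B₁, hB₁⟩ := hK.exists_bound_of_continuousOn (hF'.continuousOn.mono hKS)
  obtain ⟨B₂, hB₂⟩ :=
    hK.exists_bound_of_continuousOn ((hF'.continuousOn_fderivWithin hS le_rfl).mono hKS)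
  have hd : ∀ x ∈ K, HasFDerivWithinAt F (fderivWithin ℝ F S x) K x := fun x hx =>
    ((hF.differentiableOn (by norm_num) x (hKS hx)).hasFDerivWithinAt).mono hKS
  have hd' : ∀ x ∈ K, HasFDerivWithinAt (fderivWithin ℝ F S)
      (fderivWithin ℝ (fderivWithin ℝ F S) S x) K x := fun x hx =>
    ((hF'.differentiableOn (by norm_num) x (hKS hx)).hasFDerivWithinAt).mono hKS
  have hB : 0 ≤ max (max B₁ B₂) 0 := le_max_right _ _
  have h₁ : B₁ ≤ max (max B₁ B₂) 0 := (le_max_left _ _).trans (le_max_left _ _)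
  have h₂ : B₂ ≤ max (max B₁ B₂) 0 := (le_max_right _ _).trans (le_max_left _ _)
  refine ⟨max (max B₁ B₂) 0, hB, fun p hp q hq => ⟨?_, ?_⟩⟩
  · exact hKc.norm_image_sub_le_of_norm_hasFDerivWithin_le hd
      (fun x hx => (hB₁ x hx).trans h₁) hp hq
  · have hseg : segment ℝ p q ⊆ K := hKc.segment_subset hp hq
    rw [pow_two, ← mul_assoc]
    refine (convex_segment p q).norm_image_sub_le_of_norm_hasFDerivWithin_le'
      (fun x hx => (hd x (hseg hx)).mono hseg) (fun x hx => ?_)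
      (left_mem_segment ℝ p q) (right_mem_segment ℝ p q)
    calc _ ≤ max (max B₁ B₂) 0 * ‖x - p‖ :=
          hKc.norm_image_sub_le_of_norm_hasFDerivWithin_le hd'
            (fun x hx => (hB₂ x hx).trans h₂) hp (hseg hx)
      _ ≤ _ := mul_le_mul_of_nonneg_left (norm_sub_le_of_mem_segment hx) hB

/-- The Fréchet derivative of an uncurried map, restricted to directions in which the last
variable is frozen, is the sum of the partial differentials. -/
theorem fderivWithin_prod_apply_eq_add {X V G : Type*} [NormedAddCommGroup X] [NormedSpace ℝ X]
    [NormedAddCommGroup V] [NormedSpace ℝ V] [NormedAddCommGroup G] [NormedSpace ℝ G]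
    {f : X → V → ℝ → G} {I : Set ℝ} {x : X} {v : V} {t : ℝ} (ht : t ∈ I)
    (hf : DifferentiableWithinAt ℝ (fun p : X × V × ℝ => f p.1 p.2.1 p.2.2)
      (univ ×ˢ univ ×ˢ I) (x, v, t)) {fx : X →L[ℝ] G} {fv : V →L[ℝ] G}
    (hfx : HasFDerivAt (fun y => f y v t) fx x) (hfv : HasFDerivAt (fun w => f x w t) fv v)
    (h : X) (k : V) :
    fderivWithin ℝ (fun p : X × V × ℝ => f p.1 p.2.1 p.2.2) (univ ×ˢ univ ×ˢ I) (x, v, t)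
      (h, k, 0) = fx h + fv k := by
  have hF := hf.hasFDerivWithinAt
  set L := fderivWithin ℝ (fun p : X × V × ℝ => f p.1 p.2.1 p.2.2) (univ ×ˢ univ ×ˢ I) (x, v, t)
  have hx : HasFDerivAt (fun y => f y v t) (L.comp (.prod (.id ℝ X) 0)) x := by
    have hι : HasFDerivWithinAt (fun y : X => (y, v, t)) (.prod (.id ℝ X) 0) univ x :=
      ((hasFDerivAt_id x).prodMk (hasFDerivAt_const (v, t) x)).hasFDerivWithinAt
    have hc := HasFDerivWithinAt.comp x hF hι fun y _ => by simp [ht]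
    exact hasFDerivWithinAt_univ.1 hc
  have hv : HasFDerivAt (fun w => f x w t) (L.comp (.prod 0 (.prod (.id ℝ V) 0))) v := by
    have hι : HasFDerivWithinAt (fun w : V => (x, w, t)) (.prod 0 (.prod (.id ℝ V) 0)) univ v :=
      ((hasFDerivAt_const x v).prodMk
        ((hasFDerivAt_id v).prodMk (hasFDerivAt_const t v))).hasFDerivWithinAt
    have hc := HasFDerivWithinAt.comp v hF hι fun y _ => by simp [ht]
    exact hasFDerivWithinAt_univ.1 hc
  rw [hfx.unique hx, hfv.unique hv]
  simp [← map_add]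

/-- Stability of order 2 for the fractional state equation: the state variable associated to
the perturbed control `u + ε ū` equals the unperturbed one plus `ε q̄` up to `O(ε²)`, where
`q̄` solves the linearised fractional Cauchy problem. -/
theorem fractional_state_stability_order_two
    (a b : ℝ) (hab : a < b) (d m : ℕ) (hd : 0 < d) (hm : 0 < m)
    (α : ℝ) (hα0 : 0 < α) (hα1 : α ≤ 1)
    (A : EuclideanSpace ℝ (Fin d))
    (f : EuclideanSpace ℝ (Fin d) → EuclideanSpace ℝ (Fin m) → ℝ → EuclideanSpace ℝ (Fin d))
    (hf : ContDiffOn ℝ 2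
      (fun p : EuclideanSpace ℝ (Fin d) × EuclideanSpace ℝ (Fin m) × ℝ => f p.1 p.2.1 p.2.2)
      (univ ×ˢ univ ×ˢ Icc a b))
    (M : ℝ) (hM : 0 ≤ M)
    (hlip : ∀ x₁ x₂ : EuclideanSpace ℝ (Fin d), ∀ v : EuclideanSpace ℝ (Fin m), ∀ t ∈ Icc a b,
      ‖f x₁ v t - f x₂ v t‖ ≤ M * ‖x₁ - x₂‖)
    -- the partial differentials of `f` with respect to its first and second variables
    (fx : EuclideanSpace ℝ (Fin d) → EuclideanSpace ℝ (Fin m) → ℝ →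
      (EuclideanSpace ℝ (Fin d) →L[ℝ] EuclideanSpace ℝ (Fin d)))
    (fv : EuclideanSpace ℝ (Fin d) → EuclideanSpace ℝ (Fin m) → ℝ →
      (EuclideanSpace ℝ (Fin m) →L[ℝ] EuclideanSpace ℝ (Fin d)))
    (hfx : ∀ x v, ∀ t ∈ Icc a b, HasFDerivAt (fun y => f y v t) (fx x v t) x)
    (hfv : ∀ x v, ∀ t ∈ Icc a b, HasFDerivAt (fun w => f x w t) (fv x v t) v)
    (u ub : ℝ → EuclideanSpace ℝ (Fin m))
    (hu : ContinuousOn u (Icc a b)) (hub : ContinuousOn ub (Icc a b))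
    (Q : ℝ → ℝ → EuclideanSpace ℝ (Fin d))
    (hQc : ∀ ε : ℝ, ContinuousOn (Q ε) (Icc a b))
    (hQ : ∀ ε : ℝ, ∀ t ∈ Icc a b,
      Q ε t = A + Ileft a α (fun s => f (Q ε s) (u s + ε • ub s) s) t)
    -- `q̄`: solution of the linearised fractional Cauchy problem
    (qb : ℝ → EuclideanSpace ℝ (Fin d)) (hqbc : ContinuousOn qb (Icc a b))
    (hqb : ∀ t ∈ Icc a b,
      qb t = Ileft a α
        (fun s => fx (Q 0 s) (u s) s (qb s) + fv (Q 0 s) (u s) s (ub s)) t) :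
    ∃ C : ℝ, 0 ≤ C ∧ ∀ ε : ℝ, |ε| < 1 → ∀ t ∈ Icc a b,
      ‖Q ε t - Q 0 t - ε • qb t‖ ≤ C * ε ^ 2 := by
  set F : EuclideanSpace ℝ (Fin d) × EuclideanSpace ℝ (Fin m) × ℝ → EuclideanSpace ℝ (Fin d) :=
    fun p => f p.1 p.2.1 p.2.2
  set S : Set (EuclideanSpace ℝ (Fin d) × EuclideanSpace ℝ (Fin m) × ℝ) :=
    univ ×ˢ univ ×ˢ Icc a b with hSdef
  have hS : UniqueDiffOn ℝ S :=
    uniqueDiffOn_univ.prod (uniqueDiffOn_univ.prod (uniqueDiffOn_Icc hab))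
  have hpart : ∀ x v, ∀ t ∈ Icc a b, ∀ h k,
      fderivWithin ℝ F S (x, v, t) (h, k, 0) = fx x v t h + fv x v t k := fun x v t ht h k =>
    fderivWithin_prod_apply_eq_add ht (hf.differentiableOn (by norm_num) _ (by simpa [hSdef] using ht))
      (hfx x v t ht) (hfv x v t ht) h k
  have hfxM : ∀ x v, ∀ t ∈ Icc a b, ‖fx x v t‖ ≤ M := fun x v t ht =>
    (hfx x v t ht).le_of_lip' hM (Eventually.of_forall fun y => hlip y x v t ht)
  have htaylor : ∀ R : ℝ, ∃ B : ℝ, 0 ≤ B ∧ ∀ x v x' v', ‖x‖ ≤ R → ‖v‖ ≤ R → ‖x'‖ ≤ R →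
      ‖v'‖ ≤ R → ∀ t ∈ Icc a b, ∀ r, ‖x' - x‖ ≤ r → ‖v' - v‖ ≤ r →
      ‖f x' v' t - f x v t‖ ≤ B * r ∧
      ‖f x' v' t - f x v t - (fx x v t (x' - x) + fv x v t (v' - v))‖ ≤ B * r ^ 2 := by
    intro R
    obtain ⟨B, hB, h⟩ := hf.exists_lipschitz_taylor_bound hS
      (K := Metric.closedBall 0 R ×ˢ Metric.closedBall 0 R ×ˢ Icc a b)
      ((isCompact_closedBall _ _).prod ((isCompact_closedBall _ _).prod isCompact_Icc))
      ((convex_closedBall _ _).prod ((convex_closedBall _ _).prod (convex_Icc a b)))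
      (prod_mono (subset_univ _) (prod_mono (subset_univ _) subset_rfl))
    refine ⟨B, hB, fun x v x' v' hx hv hx' hv' t ht r hxr hvr => ?_⟩
    have hsub : (x', v', t) - (x, v, t) = (x' - x, v' - v, (0 : ℝ)) := by simp
    have hnorm : ‖(x', v', t) - (x, v, t)‖ ≤ r := by
      rw [hsub, Prod.norm_mk, Prod.norm_mk, norm_zero]
      exact max_le hxr (max_le hvr ((norm_nonneg _).trans hxr))
    obtain ⟨h₁, h₂⟩ := h (x, v, t) (by simp [hx, hv, ht.1, ht.2]) (x', v', t)
      (by simp [hx', hv', ht.1, ht.2])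
    refine ⟨h₁.trans (by gcongr), ?_⟩
    rw [hsub, hpart x v t ht, ← hsub] at h₂
    exact h₂.trans (by gcongr)
  have hgc : ∀ ε, ContinuousOn (fun s => f (Q ε s) (u s + ε • ub s) s) (Icc a b) := fun ε =>
    hf.continuousOn.comp (f := fun s => (Q ε s, u s + ε • ub s, s))
      ((hQc ε).prodMk ((hu.add (hub.const_smul ε)).prodMk continuousOn_id))
      fun s hs => by simpa [hSdef] using hs
  have hlc : ContinuousOn
      (fun s => fx (Q 0 s) (u s) s (qb s) + fv (Q 0 s) (u s) s (ub s)) (Icc a b) := by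
    have h := (hf.continuousOn_fderivWithin hS (by norm_num)).comp
      (f := fun s => (Q 0 s, u s, s)) ((hQc 0).prodMk (hu.prodMk continuousOn_id))
      (t := S) (s := Icc a b) fun s hs => by simpa [hSdef] using hs
    refine (h.clm_apply (hqbc.prodMk (hub.prodMk (continuousOn_const (c := (0 : ℝ)))))).congr
      fun s hs => ?_
    exact (hpart (Q 0 s) (u s) s hs (qb s) (ub s)).symm
  obtain ⟨CQ, hCQ⟩ := isCompact_Icc.exists_bound_of_continuousOn (hQc 0)
  obtain ⟨Cu, hCu⟩ := isCompact_Icc.exists_bound_of_continuousOn hu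
  obtain ⟨Cub, hCub⟩ := isCompact_Icc.exists_bound_of_continuousOn hub
  have ha : a ∈ Icc a b := left_mem_Icc.2 hab.le
  have hCQ0 : 0 ≤ CQ := (norm_nonneg _).trans (hCQ a ha)
  have hCu0 : 0 ≤ Cu := (norm_nonneg _).trans (hCu a ha)
  have hCub0 : 0 ≤ Cub := (norm_nonneg _).trans (hCub a ha)
  have hεub : ∀ ε : ℝ, ∀ s ∈ Icc a b, ‖ε • ub s‖ ≤ |ε| * Cub := fun ε s hs => by
    rw [norm_smul, Real.norm_eq_abs]
    exact mul_le_mul_of_nonneg_left (hCub s hs) (abs_nonneg ε)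
  have huε : ∀ ε : ℝ, |ε| < 1 → ∀ s ∈ Icc a b, ‖u s + ε • ub s‖ ≤ Cu + Cub := fun ε hε s hs =>
    norm_add_le_of_le (hCu s hs)
      ((hεub ε s hs).trans (mul_le_of_le_one_left hCub0 hε.le))
  obtain ⟨G, hG, hgron⟩ :=
    exists_norm_le_of_eq_Ileft (E := EuclideanSpace ℝ (Fin d)) a b hα0 hM
  have hdiff : ∀ ε, ∀ t ∈ Icc a b, Q ε t - Q 0 t = Ileft a α (fun s =>
      f (Q ε s) (u s + ε • ub s) s - f (Q 0 s) (u s) s) t := fun ε t ht => by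
    have hg0 := hgc 0
    have hQ0 := hQ 0 t ht
    simp only [zero_smul, add_zero] at hg0 hQ0
    rw [Ileft_sub hα0 ht (hgc ε) hg0, hQ ε t ht, hQ0]
    abel
  obtain ⟨B₁, hB₁, hlipv⟩ := htaylor (CQ + Cu + Cub)
  have hfirst : ∀ ε : ℝ, |ε| < 1 → ∀ t ∈ Icc a b,
      ‖Q ε t - Q 0 t‖ ≤ G * (B₁ * (|ε| * Cub)) := by
    intro ε hε
    refine hgron _ _ _ (by positivity) ((hQc ε).sub (hQc 0)) (hdiff ε) fun s hs => ?_
    have h₁ := hlip (Q ε s) (Q 0 s) (u s + ε • ub s) s hs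
    have h₂ := (hlipv (Q 0 s) (u s) (Q 0 s) (u s + ε • ub s) (by linarith [hCQ s hs])
      (by linarith [hCu s hs]) (by linarith [hCQ s hs]) (by linarith [huε ε hε s hs]) s hs
      (|ε| * Cub) (by rw [sub_self, norm_zero]; positivity)
      (by rw [add_sub_cancel_left]; exact hεub ε s hs)).1
    have h₃ := norm_sub_le_norm_sub_add_norm_sub (f (Q ε s) (u s + ε • ub s) s)
      (f (Q 0 s) (u s + ε • ub s) s) (f (Q 0 s) (u s) s)
    linarith
  obtain ⟨B₂, hB₂, htay⟩ := htaylor (CQ + G * (B₁ * Cub) + Cu + Cub)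
  refine ⟨G * (B₂ * (G * (B₁ * Cub) + Cub) ^ 2), by positivity, fun ε hε => ?_⟩
  suffices h : ∀ t ∈ Icc a b, ‖Q ε t - Q 0 t - ε • qb t‖ ≤
      G * (B₂ * (|ε| * (G * (B₁ * Cub) + Cub)) ^ 2) by
    intro t ht
    refine (h t ht).trans_eq ?_
    rw [mul_pow, sq_abs]
    ring
  refine hgron _ (fun s => f (Q ε s) (u s + ε • ub s) s - f (Q 0 s) (u s) s -
    ε • (fx (Q 0 s) (u s) s (qb s) + fv (Q 0 s) (u s) s (ub s))) _ (by positivity)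
    (((hQc ε).sub (hQc 0)).sub (hqbc.const_smul ε)) (fun t ht => ?_) fun s hs => ?_
  · have hg0 := hgc 0
    simp only [zero_smul, add_zero] at hg0
    have hsub := Ileft_sub hα0 ht ((hgc ε).sub hg0) (hlc.const_smul ε)
    simp only [Pi.sub_apply, Pi.smul_apply] at hsub
    rw [hsub]
    exact congrArg₂ (· - ·) (hdiff ε t ht)
      ((congrArg (ε • ·) (hqb t ht)).trans (Ileft_const_smul a α ε t _).symm)
  · have hP : 0 ≤ G * (B₁ * Cub) := by positivity
    have hQs : ‖Q ε s - Q 0 s‖ ≤ |ε| * (G * (B₁ * Cub)) := (hfirst ε hε s hs).trans_eq (by ring)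
    have hQs1 : ‖Q ε s - Q 0 s‖ ≤ G * (B₁ * Cub) :=
      hQs.trans (mul_le_of_le_one_left hP hε.le)
    have hQε : ‖Q ε s‖ ≤ CQ + G * (B₁ * Cub) := by
      linarith [norm_le_norm_add_norm_sub' (Q ε s) (Q 0 s), hCQ s hs]
    have hε0 := abs_nonneg ε
    have h₁ := (htay (Q 0 s) (u s) (Q ε s) (u s + ε • ub s) (by linarith [hCQ s hs])
      (by linarith [hCu s hs]) (by linarith) (by linarith [huε ε hε s hs]) s hs
      (|ε| * (G * (B₁ * Cub) + Cub)) (hQs.trans (by gcongr; linarith))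
      (by rw [add_sub_cancel_left]; exact (hεub ε s hs).trans (by gcongr; linarith))).2
    have h₂ : ‖fx (Q 0 s) (u s) s (Q ε s - Q 0 s - ε • qb s)‖ ≤
        M * ‖Q ε s - Q 0 s - ε • qb s‖ :=
      (fx (Q 0 s) (u s) s).le_of_opNorm_le (hfxM _ _ s hs) _
    refine (le_of_eq (congrArg norm ?_)).trans (norm_add_le_of_le h₂ h₁)
    simp only [map_sub, map_smul, smul_add, add_sub_cancel_left]
    abel
end
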